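/- Let B ∈ ℂ^{M×M} be a Hermitian positive semidefinite matrix of rank K, let σ² > 0 and κ ∈ (0,1). Then the limit as ρ → ∞ of [log₂ det(I_M + (ρ/σ²)·B) − log₂ det(I_M + ((1−κ)ρ/σ²)·B)] equals K · log₂(1/(1−κ)). -/

import Mathlib

open scoped ComplexOrder

open Unitary in
/-- The determinant of `1 + t • A` for Hermitian `A`, in terms of the eigenvalues of `A`. -/
lemma Matrix.IsHermitian.det_one_add_smul {n 𝕜 : Type*} [Fintype n] [DecidableEq n] [RCLike 𝕜]
    {A : Matrix n n 𝕜} (hA : A.IsHermitian) (t : ℝ) :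
    (1 + (t : 𝕜) • A).det = ((∏ i, (1 + t * hA.eigenvalues i) : ℝ) : 𝕜) := by
  have h : 1 + (t : 𝕜) • A = conjStarAlgAut 𝕜 _ hA.eigenvectorUnitary
      (1 + (t : 𝕜) • Matrix.diagonal (RCLike.ofReal ∘ hA.eigenvalues)) := by
    rw [map_add, map_one, map_smul, ← hA.spectral_theorem]
  rw [h, conjStarAlgAut_apply, Matrix.det_mul_comm, ← mul_assoc, Unitary.coe_star_mul_self,
    one_mul, ← Matrix.diagonal_one, ← Matrix.diagonal_smul, Matrix.diagonal_add,
    Matrix.det_diagonal]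
  simp

open Filter Topology in
/-- The difference of logarithms `logb b (1 + s) - logb b (1 + c * s)` converges to
`logb b (1 / c)` at infinity. -/
lemma Real.tendsto_logb_one_add_sub_logb_one_add_mul (b : ℝ) {c : ℝ} (hc : 0 < c) :
    Tendsto (fun s : ℝ => Real.logb b (1 + s) - Real.logb b (1 + c * s)) atTop
      (𝓝 (Real.logb b (1 / c))) := by
  have hratio : Tendsto (fun s : ℝ => 1 / c + (1 - 1 / c) / (1 + c * s)) atTop (𝓝 (1 / c)) := by
    have hden : Tendsto (fun s : ℝ => 1 + c * s) atTop atTop :=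
      tendsto_atTop_add_const_left _ _ (tendsto_id.const_mul_atTop hc)
    simpa using (hden.const_div_atTop (1 - 1 / c)).const_add (1 / c)
  have hlog := (hratio.log (by positivity)).div_const (Real.log b)
  refine hlog.congr' ?_
  filter_upwards [eventually_ge_atTop 0] with s hs
  have hcs : 0 < 1 + c * s := by positivity
  rw [← Real.logb_div (by positivity) hcs.ne', Real.logb]
  congr 2
  field_simp
  ring

open Filter Topology in
/-- The contribution of an eigenvalue `a` to the high-power limit. -/
lemma Real.tendsto_logb_one_add_mul_sub_of_nonneg (b : ℝ) {c a : ℝ} (hc : 0 < c) (ha : 0 ≤ a) :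
    Tendsto (fun x : ℝ => Real.logb b (1 + x * a) - Real.logb b (1 + c * x * a)) atTop
      (𝓝 (if a ≠ 0 then Real.logb b (1 / c) else 0)) := by
  rcases ha.eq_or_lt with rfl | ha
  · simp
  · rw [if_pos ha.ne']
    simpa [Function.comp_def, mul_assoc] using
      (Real.tendsto_logb_one_add_sub_logb_one_add_mul b hc).comp (tendsto_id.atTop_mul_const ha)

/-- Single-subcarrier core of Proposition 1: for Hermitian positive semidefinite
`B ∈ ℂ^{M×M}` of rank `K`, `σ² > 0`, and `κ ∈ (0,1)`,
`log₂ det(I + (ρ/σ²)B) − log₂ det(I + ((1−κ)ρ/σ²)B) → K·log₂(1/(1−κ))` as `ρ → ∞`. -/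
theorem stmt_13 (M K : ℕ) (B : Matrix (Fin M) (Fin M) ℂ) (hB : B.PosSemidef)
    (hrank : B.rank = K) (σ2 κ : ℝ) (hσ : 0 < σ2) (hκ : κ ∈ Set.Ioo (0:ℝ) 1) :
    Filter.Tendsto
      (fun ρ : ℝ =>
        Real.logb 2 ((1 + ((ρ / σ2 : ℝ) : ℂ) • B).det.re) -
          Real.logb 2 ((1 + (((1 - κ) * ρ / σ2 : ℝ) : ℂ) • B).det.re))
      Filter.atTop (nhds (K * Real.logb 2 (1 / (1 - κ)))) := by
  have hc : 0 < 1 - κ := sub_pos.mpr hκ.2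
  have hlim := (tendsto_finsetSum Finset.univ fun i _ =>
    Real.tendsto_logb_one_add_mul_sub_of_nonneg 2 hc (hB.eigenvalues_nonneg i)).comp
      (Filter.tendsto_id.atTop_div_const hσ)
  have hsum : (∑ i, if hB.isHermitian.eigenvalues i ≠ 0 then Real.logb 2 (1 / (1 - κ)) else 0)
      = K * Real.logb 2 (1 / (1 - κ)) := by
    rw [← hrank, hB.isHermitian.rank_eq_card_non_zero_eigs, Fintype.card_subtype,
      ← Finset.sum_filter, Finset.sum_const, nsmul_eq_mul]
  rw [hsum] at hlim
  refine hlim.congr' ?_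
  filter_upwards [Filter.eventually_ge_atTop 0] with ρ hρ
  have hlogdet : ∀ t : ℝ, 0 ≤ t → Real.logb 2 ((1 + (t : ℂ) • B).det.re) =
      ∑ i, Real.logb 2 (1 + t * hB.isHermitian.eigenvalues i) := by
    intro t ht
    have hdet : (1 + (t : ℂ) • B).det = _ := hB.isHermitian.det_one_add_smul t
    rw [hdet, RCLike.ofReal_eq_complex_ofReal, Complex.ofReal_re, Real.logb_prod]
    intro i _
    have := mul_nonneg ht (hB.eigenvalues_nonneg i)
    positivity
  rw [hlogdet _ (by positivity), hlogdet _ (by positivity), ← Finset.sum_sub_distrib]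
  simp [mul_div_assoc]
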